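/- For every tapped ratio α with 1 ≤ α ≤ 2 (that is, when the adversary can tap longer than one full phase of communication) and every library size D ≥ 2, the strong secrecy capacity of the CBC-WCT II equals C_s(α) = 1 − α/2. -/

import Mathlib

open scoped BigOperators
open Filter

namespace CBC

/-- The distribution of a random variable `X` on a finite sample space with
probability mass function `P`. -/
noncomputable def dist {Ω A : Type*} [Fintype Ω] [DecidableEq A]
    (P : Ω → ℝ) (X : Ω → A) (a : A) : ℝ :=
  ∑ ω, if X ω = a then P ω else 0

/-- Mutual information `I(X;Y)` of two finite-valued random variables on a finite
sample space with probability mass function `P`: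
`I(X;Y) = Σ_{a,b} P(X=a,Y=b) log ( P(X=a,Y=b) / (P(X=a) P(Y=b)) )`. -/
noncomputable def mutInfo {Ω A B : Type*} [Fintype Ω] [Fintype A] [Fintype B]
    [DecidableEq A] [DecidableEq B] (P : Ω → ℝ) (X : Ω → A) (Y : Ω → B) : ℝ :=
  ∑ a : A, ∑ b : B,
    dist P (fun ω => (X ω, Y ω)) (a, b) *
      Real.log (dist P (fun ω => (X ω, Y ω)) (a, b) / (dist P X a * dist P Y b))

/-- A channel code for the caching broadcast channel with a wire and cache tapping
adversary of type II (CBC-WCT II), with library size `D`, blocklength `n`,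
message-set size `M` (so each file is uniform over `Fin M`, representing
`[1:2^{nR_s}]`) and cache size `C` (representing `[1:2^{n/2}]`).
Encoders may use private randomness: a finite randomness alphabet `Fin (nr+1)`
with probability mass function `q`. -/
structure Code (D n M C : ℕ) where
  /-- size (minus one) of the encoder's private randomness alphabet -/
  nr : ℕ
  /-- probability mass function of the encoder's private randomness -/
  q : Fin (nr + 1) → ℝ
  q_nonneg : ∀ θ, 0 ≤ q θ
  q_sum : ∑ θ, q θ = 1
  /-- cache placement encoder: sends `X_c^n ∈ {0,1}^n` as a (stochastic) function
  of the library files -/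
  encC : (Fin D → Fin M) → Fin (nr + 1) → (Fin n → Bool)
  /-- cache decoder of receiver `j ∈ {1,2}`: stores `M_{c,j} = f_{c,j}(X_c^n)` -/
  cacheF : Fin 2 → (Fin n → Bool) → Fin C
  /-- delivery encoder for demand vector `d = (d₁,d₂)`: sends `X_d^n ∈ {0,1}^n` -/
  encD : Fin D × Fin D → (Fin D → Fin M) → Fin (nr + 1) → (Fin n → Bool)
  /-- decoder of receiver `j`: `Ŵ_{d_j} = g_{d,j}(M_{c,j}, X_d^n)` -/
  dec : Fin D × Fin D → Fin 2 → Fin C → (Fin n → Bool) → Fin M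

/-- The joint probability mass function of the (independent, uniform) library files
and the encoder randomness. -/
noncomputable def Code.P {D n M C : ℕ} (c : Code D n M C) :
    ((Fin D → Fin M) × Fin (c.nr + 1)) → ℝ :=
  fun ωθ => (1 / (M : ℝ) ^ D) * c.q ωθ.2

/-- Probability of decoding error under demand vector `d`:
`P(Ŵ_{d₁} ≠ W_{d₁} or Ŵ_{d₂} ≠ W_{d₂})`. -/
noncomputable def Code.errProb {D n M C : ℕ} (c : Code D n M C)
    (d : Fin D × Fin D) : ℝ :=
  ∑ ωθ : (Fin D → Fin M) × Fin (c.nr + 1),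
    if c.dec d 0 (c.cacheF 0 (c.encC ωθ.1 ωθ.2)) (c.encD d ωθ.1 ωθ.2) ≠ ωθ.1 d.1 ∨
       c.dec d 1 (c.cacheF 1 (c.encC ωθ.1 ωθ.2)) (c.encD d ωθ.1 ωθ.2) ≠ ωθ.1 d.2
    then c.P ωθ else 0

/-- The adversary's observation of a length-`n` binary word when tapping the
positions in `S`: position `i` shows the transmitted bit if `i ∈ S` and the
erasure symbol `?` (here `none`) otherwise. -/
def tap {n : ℕ} (S : Finset (Fin n)) (x : Fin n → Bool) : Fin n → Option Bool :=
  fun i => if i ∈ S then some (x i) else none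

/-- Information leakage `I(W₁,…,W_D ; Z_{S₁}^n, Z_{S₂}^n)` to an adversary tapping
positions `S₁` of the cache placement transmission and `S₂` of the delivery
transmission, under demand vector `d`. -/
noncomputable def Code.leak {D n M C : ℕ} (c : Code D n M C)
    (d : Fin D × Fin D) (S1 S2 : Finset (Fin n)) : ℝ :=
  mutInfo c.P (fun ωθ => ωθ.1)
    (fun ωθ => (tap S1 (c.encC ωθ.1 ωθ.2), tap S2 (c.encD d ωθ.1 ωθ.2)))

/-- Number of messages per file at blocklength `n` and file rate `R`: `2^{nR}`. -/
noncomputable def msgCount (n : ℕ) (R : ℝ) : ℕ := ⌊(2 : ℝ) ^ ((n : ℝ) * R)⌋₊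

/-- Size of each receiver's cache memory at blocklength `n`: `2^{n/2}`
(a cache of `n/2` bits). -/
noncomputable def cacheSize (n : ℕ) : ℕ := ⌊(2 : ℝ) ^ ((n : ℝ) / 2)⌋₊

/-- The file rate `R` is achievable with strong secrecy with respect to the family
`Allowed` of admissible adversary tapping-set pairs `(S₁,S₂)`: there is a sequence
of codes whose worst-case (over demand vectors) error probability vanishes and
whose worst-case (over demand vectors and allowed tapping sets) information
leakage vanishes as `n → ∞`. -/
def AchievableW (D : ℕ)
    (Allowed : (n : ℕ) → Finset (Fin n) → Finset (Fin n) → Prop) (R : ℝ) : Prop :=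
  ∃ (c : ∀ n : ℕ, Code D n (msgCount n R) (cacheSize n)) (ε δ : ℕ → ℝ),
    Tendsto ε atTop (nhds 0) ∧ Tendsto δ atTop (nhds 0) ∧
    (∀ n, ∀ d : Fin D × Fin D, (c n).errProb d ≤ ε n) ∧
    (∀ n, ∀ d : Fin D × Fin D, ∀ S1 S2 : Finset (Fin n), Allowed n S1 S2 →
      |(c n).leak d S1 S2| ≤ δ n)

/-- The file rate `R` is achievable with strong secrecy against an adversary of
type II who may tap any sets `S₁, S₂ ⊆ [1:n]` with `|S₁| + |S₂| ≤ μ = αn`. -/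
def Achievable (D : ℕ) (α : ℝ) (R : ℝ) : Prop :=
  AchievableW D (fun n S1 S2 => ((S1.card : ℝ) + (S2.card : ℝ)) ≤ α * n) R

/-- The strong secrecy capacity `C_s(α)` of the CBC-WCT II with library size `D`:
the supremum of all file rates achievable with strong secrecy. -/
noncomputable def capacity (D : ℕ) (α : ℝ) : ℝ :=
  sSup {R : ℝ | Achievable D α R}


lemma sum_dist_mul {Ω A : Type*} [Fintype Ω] [Fintype A] [DecidableEq A]
    (P : Ω → ℝ) (X : Ω → A) (g : A → ℝ) :
    ∑ a, dist P X a * g a = ∑ ω, P ω * g (X ω) := by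
  simp only [dist, Finset.sum_mul]
  rw [Finset.sum_comm]
  refine Finset.sum_congr rfl fun ω _ => ?_
  simp [ite_mul]

lemma dist_nonneg {Ω A : Type*} [Fintype Ω] [DecidableEq A] {P : Ω → ℝ}
    (hP : ∀ ω, 0 ≤ P ω) (X : Ω → A) (a : A) : 0 ≤ dist P X a :=
  Finset.sum_nonneg fun ω _ => by split_ifs <;> simp [hP]

lemma dist_prod_le_left {Ω A B : Type*} [Fintype Ω] [DecidableEq A] [DecidableEq B]
    {P : Ω → ℝ} (hP : ∀ ω, 0 ≤ P ω) (X : Ω → A) (Y : Ω → B) (a : A) (b : B) :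
    dist P (fun ω => (X ω, Y ω)) (a, b) ≤ dist P X a :=
  Finset.sum_le_sum fun ω _ => by
    have := hP ω
    by_cases h : X ω = a <;> by_cases h' : Y ω = b <;> simp [h, h', this]

lemma dist_prod_le_right {Ω A B : Type*} [Fintype Ω] [DecidableEq A] [DecidableEq B]
    {P : Ω → ℝ} (hP : ∀ ω, 0 ≤ P ω) (X : Ω → A) (Y : Ω → B) (a : A) (b : B) :
    dist P (fun ω => (X ω, Y ω)) (a, b) ≤ dist P Y b :=
  Finset.sum_le_sum fun ω _ => by
    have := hP ω
    by_cases h : X ω = a <;> by_cases h' : Y ω = b <;> simp [h, h', this]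

/-- Variational lower bound on mutual information by an arbitrary guessing kernel `Q`. -/
lemma sum_mul_log_le_mutInfo {Ω A B : Type*} [Fintype Ω] [Fintype A] [Fintype B]
    [DecidableEq A] [DecidableEq B] {P : Ω → ℝ} (hP : ∀ ω, 0 ≤ P ω)
    (X : Ω → A) (Y : Ω → B) (Q : A → B → ℝ) (hQ : ∀ ω, 0 < P ω → 0 < Q (X ω) (Y ω))
    (hQ0 : ∀ a b, 0 ≤ Q a b) (hQ1 : ∀ b, ∑ a, Q a b ≤ 1) :
    ∑ ω, P ω * Real.log (Q (X ω) (Y ω) / dist P X (X ω)) ≤ mutInfo P X Y := by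
  set p : A → B → ℝ := fun a b => dist P (fun ω => (X ω, Y ω)) (a, b) with hp
  have key : ∀ a b, p a b * Real.log (Q a b / dist P X a) + (p a b - Q a b * dist P Y b) ≤
      p a b * Real.log (p a b / (dist P X a * dist P Y b)) := by
    intro a b
    have hpa : p a b ≤ dist P X a := dist_prod_le_left hP X Y a b
    have hpb : p a b ≤ dist P Y b := dist_prod_le_right hP X Y a b
    rcases (dist_nonneg hP (fun ω => (X ω, Y ω)) (a, b)).eq_or_lt' with h0 | h0
    · have h0' : p a b = 0 := h0
      have := mul_nonneg (hQ0 a b) (dist_nonneg hP Y b)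
      rw [h0']; simp; linarith
    · change 0 < p a b at h0
      have ha : 0 < dist P X a := h0.trans_le hpa
      have hb : 0 < dist P Y b := h0.trans_le hpb
      have hq : 0 < Q a b := by
        have h1 : ∃ ω ∈ Finset.univ, 0 < if (X ω, Y ω) = (a, b) then P ω else 0 := by
          by_contra! hcon
          exact absurd (Finset.sum_nonpos hcon) (not_le.2 h0)
        obtain ⟨ω, -, hω⟩ := h1
        split_ifs at hω with h
        · obtain ⟨rfl, rfl⟩ := Prod.mk.inj h
          exact hQ ω hω
        · exact absurd hω (lt_irrefl _)
      have e : Real.log (p a b / (dist P X a * dist P Y b)) =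
          Real.log (Q a b / dist P X a) - Real.log (Q a b * dist P Y b / p a b) := by
        rw [← Real.log_div (by positivity) (by positivity)]
        congr 1
        field_simp
      have hl := Real.log_le_sub_one_of_pos (x := Q a b * dist P Y b / p a b) (by positivity)
      have h3 : p a b * (Q a b * dist P Y b / p a b) = Q a b * dist P Y b := by field_simp
      rw [e]
      nlinarith
  have hsum : ∑ ω, P ω * Real.log (Q (X ω) (Y ω) / dist P X (X ω)) =
      ∑ a, ∑ b, p a b * Real.log (Q a b / dist P X a) := by
    rw [← sum_dist_mul P (fun ω => (X ω, Y ω))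
      (fun ab => Real.log (Q ab.1 ab.2 / dist P X ab.1)), Fintype.sum_prod_type]
  have hp1 : ∑ a, ∑ b, p a b = ∑ ω, P ω := by
    have := sum_dist_mul P (fun ω => (X ω, Y ω)) (fun _ => 1)
    simpa [Fintype.sum_prod_type] using this
  have hp2 : ∑ a, ∑ b, Q a b * dist P Y b ≤ ∑ ω, P ω := by
    have := sum_dist_mul P Y (fun _ => 1)
    simp only [mul_one] at this
    rw [← this, Finset.sum_comm]
    refine Finset.sum_le_sum fun b _ => ?_
    rw [← Finset.sum_mul]
    exact mul_le_of_le_one_left (dist_nonneg hP Y b) (hQ1 b)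
  have := Finset.sum_le_sum fun a (_ : a ∈ Finset.univ) =>
    Finset.sum_le_sum fun b (_ : b ∈ Finset.univ) => key a b
  simp only [Finset.sum_add_distrib, Finset.sum_sub_distrib] at this
  rw [hsum]
  unfold mutInfo
  linarith

lemma mutInfo_nonneg {Ω A B : Type*} [Fintype Ω] [Fintype A] [Fintype B]
    [DecidableEq A] [DecidableEq B] {P : Ω → ℝ} (hP : ∀ ω, 0 ≤ P ω) (hP1 : ∑ ω, P ω = 1)
    (X : Ω → A) (Y : Ω → B) : 0 ≤ mutInfo P X Y := by
  have hpos : ∀ ω, 0 < P ω → 0 < dist P X (X ω) := fun ω hω =>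
    hω.trans_le <| by
      have := Finset.single_le_sum (f := fun ω' => if X ω' = X ω then P ω' else 0)
        (fun ω' _ => by split_ifs <;> simp [hP]) (Finset.mem_univ ω)
      simpa [dist] using this
  have h := sum_mul_log_le_mutInfo hP X Y (fun a _ => dist P X a) hpos
    (fun a _ => dist_nonneg hP X a)
    (fun _ => by
      have := sum_dist_mul P X (fun _ => 1)
      simp only [mul_one, hP1] at this
      exact this.le)
  refine le_trans (le_of_eq ?_) h
  symm
  refine Finset.sum_eq_zero fun ω _ => ?_
  rcases (hP ω).eq_or_lt' with h0 | h0
  · simp [h0]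
  · rw [div_self (hpos ω h0).ne']; simp

lemma add_mul_log_div_le {a b b' N : ℝ} (ha : 0 ≤ a) (hb : 0 ≤ b) (hN : 1 ≤ N)
    (hbb : b ≤ N * b') : (a + b) * Real.log ((a + b) / (a + b')) ≤ b * Real.log N := by
  have hN0 : 0 < N := by linarith
  rcases hb.eq_or_lt' with rfl | hb0
  · have hb' : 0 ≤ b' := nonneg_of_mul_nonneg_right (by linarith) hN0
    have : Real.log ((a + 0) / (a + b')) ≤ 0 := by
      apply Real.log_nonpos
      · positivity
      · exact div_le_one_of_le₀ (by linarith) (by positivity)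
    simpa using mul_nonpos_of_nonneg_of_nonpos ha (by simpa using this)
  · have hb' : 0 < b' := pos_of_mul_pos_right (by linarith : 0 < N * b') hN0.le
    have hab : 0 < a + b := by linarith
    have hab' : 0 < a + b' := by linarith
    have h1 := Real.log_le_sub_one_of_pos (x := (a + b) / (a + b')) (by positivity)
    have h2 := Real.log_le_sub_one_of_pos (x := (a + b) / (a + b') / N) (by positivity)
    rw [Real.log_div (by positivity) (by positivity)] at h2
    have h3 : b * ((a + b) / (a + b') / N) ≤ b' * ((a + b) / (a + b')) := by
      have : b * ((a + b) / (a + b') / N) = (b / N) * ((a + b) / (a + b')) := by ring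
      rw [this]
      gcongr
      rw [div_le_iff₀ hN0]; linarith
    have h4 : (a + b') * ((a + b) / (a + b')) = a + b := by field_simp
    nlinarith [mul_le_mul_of_nonneg_left h1 ha, mul_le_mul_of_nonneg_left h2 hb]

/-- If, outside a set of randomness of mass `η`, the law of the observation does not depend on
the message, then the leakage about a uniform message is at most `η` times its entropy. -/
lemma mutInfo_le_of_shift {W Θ Z : Type*} [Fintype W] [Fintype Θ] [Fintype Z]
    [DecidableEq W] [DecidableEq Z] [Nonempty W] (q : Θ → ℝ) (hq : ∀ θ, 0 ≤ q θ)
    (hq1 : ∑ θ, q θ = 1) (N : ℝ) (hN : N = Fintype.card W)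
    (f : W → Θ → Z) (good : Θ → Prop) [DecidablePred good]
    (hφ : ∀ w w', ∃ φ : Θ ≃ Θ, ∀ θ, q (φ θ) = q θ ∧ (good (φ θ) ↔ good θ) ∧
      (good θ → f w' (φ θ) = f w θ)) :
    mutInfo (fun ω : W × Θ => 1 / N * q ω.2) (fun ω => ω.1) (fun ω => f ω.1 ω.2) ≤
      (∑ θ, if good θ then 0 else q θ) * Real.log N := by
  have hN1 : 1 ≤ N := by rw [hN]; exact_mod_cast Fintype.card_pos
  have hN0 : 0 < N := by linarith
  set a : W → Z → ℝ := fun w z => ∑ θ, if f w θ = z ∧ good θ then q θ else 0 with ha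
  set b : W → Z → ℝ := fun w z => ∑ θ, if f w θ = z ∧ ¬ good θ then q θ else 0 with hb
  have haa : ∀ w w' z, a w z = a w' z := by
    intro w w' z
    obtain ⟨φ, hφ⟩ := hφ w' w
    simp only [ha]
    rw [← Equiv.sum_comp φ]
    refine Finset.sum_congr rfl fun θ _ => ?_
    obtain ⟨h1, h2, h3⟩ := hφ θ
    by_cases hg : good θ
    · simp [h1, h2, hg, h3 hg]
    · simp [h2, hg]
  have ha0 : ∀ w z, 0 ≤ a w z := fun w z =>
    Finset.sum_nonneg fun θ _ => by split_ifs <;> simp [hq]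
  have hb0 : ∀ w z, 0 ≤ b w z := fun w z =>
    Finset.sum_nonneg fun θ _ => by split_ifs <;> simp [hq]
  have hjoint : ∀ w z, dist (fun ω : W × Θ => 1 / N * q ω.2)
      (fun ω => (ω.1, f ω.1 ω.2)) (w, z) = 1 / N * (a w z + b w z) := by
    intro w z
    simp only [dist, Fintype.sum_prod_type, Prod.mk.injEq, ha, hb]
    rw [Finset.sum_eq_single w]
    · rw [← Finset.sum_add_distrib, Finset.mul_sum]
      refine Finset.sum_congr rfl fun θ _ => ?_
      by_cases h1 : f w θ = z <;> by_cases h2 : good θ <;> simp [h1, h2]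
    · intro w' _ h; simp [h]
    · simp
  have hW : ∀ w, dist (fun ω : W × Θ => 1 / N * q ω.2) (fun ω => ω.1) w = 1 / N := by
    intro w
    simp only [dist, Fintype.sum_prod_type]
    rw [Finset.sum_eq_single w]
    · simp [← Finset.mul_sum, hq1]
    · intro w' _ h; simp [h]
    · simp
  have hZ : ∀ w z, dist (fun ω : W × Θ => 1 / N * q ω.2) (fun ω => f ω.1 ω.2) z =
      a w z + 1 / N * ∑ w', b w' z := by
    intro w z
    have h1 : dist (fun ω : W × Θ => 1 / N * q ω.2) (fun ω => f ω.1 ω.2) z =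
        ∑ w', 1 / N * (a w' z + b w' z) := by
      simp only [← hjoint, dist]
      rw [Finset.sum_comm]
      refine Finset.sum_congr rfl fun ω _ => ?_
      simp [Prod.ext_iff, ite_and]
    rw [h1, ← Finset.mul_sum, Finset.sum_add_distrib, Finset.sum_congr rfl
      fun w' _ => haa w' w z]
    simp only [Finset.sum_const, Finset.card_univ, nsmul_eq_mul, ← hN]
    field_simp
  have hterm : ∀ w z, dist (fun ω : W × Θ => 1 / N * q ω.2)
      (fun ω => (ω.1, f ω.1 ω.2)) (w, z) * Real.log (dist (fun ω : W × Θ => 1 / N * q ω.2)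
      (fun ω => (ω.1, f ω.1 ω.2)) (w, z) / (dist (fun ω : W × Θ => 1 / N * q ω.2)
      (fun ω => ω.1) w * dist (fun ω : W × Θ => 1 / N * q ω.2) (fun ω => f ω.1 ω.2) z)) ≤
      1 / N * (b w z * Real.log N) := by
    intro w z
    rw [hjoint, hW, hZ w, mul_div_mul_left _ _ (by positivity), mul_assoc]
    refine mul_le_mul_of_nonneg_left ?_ (by positivity)
    refine add_mul_log_div_le (ha0 w z) (hb0 w z) hN1 ?_
    have := Finset.single_le_sum (f := fun w' => b w' z) (fun w' _ => hb0 w' z)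
      (Finset.mem_univ w)
    rw [← mul_assoc, mul_one_div_cancel hN0.ne', one_mul]
    exact this
  have hbs : ∀ w, ∑ z, b w z = ∑ θ, if good θ then 0 else q θ := by
    intro w
    simp only [hb]
    rw [Finset.sum_comm]
    refine Finset.sum_congr rfl fun θ _ => ?_
    by_cases h : good θ <;> simp [h]
  unfold mutInfo
  refine (Finset.sum_le_sum fun w _ => Finset.sum_le_sum fun z _ => hterm w z).trans ?_
  simp only [← Finset.mul_sum, ← Finset.sum_mul, hbs, Finset.sum_const, Finset.card_univ,
    nsmul_eq_mul, ← hN]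
  field_simp
  rfl

/-- The columns `G j`, `j ∈ U`, span the target space. -/
def Covers {J V : Type*} [Fintype J] [AddCommGroup V] [Module (ZMod 2) V]
    (G : J → V) (U : Finset J) : Prop :=
  ∀ u : V, ∃ v : J → ZMod 2, (∀ j, j ∉ U → v j = 0) ∧ ∑ j, v j • G j = u

lemma exists_dual_of_not_covers {J V : Type*} [Fintype J] [AddCommGroup V]
    [Module (ZMod 2) V] {G : J → V} {U : Finset J} (h : ¬ Covers G U) :
    ∃ φ : Module.Dual (ZMod 2) V, φ ≠ 0 ∧ ∀ j ∈ U, φ (G j) = 0 := by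
  classical
  have hlt : Submodule.span (ZMod 2) (G '' U) < ⊤ := by
    rw [lt_top_iff_ne_top]
    intro htop
    apply h
    intro u
    have hu : u ∈ Submodule.span (ZMod 2) (G '' U) := htop ▸ Submodule.mem_top
    rw [Submodule.mem_span_image_finset_iff_exists_fun] at hu
    obtain ⟨c, hc⟩ := hu
    refine ⟨fun j => if hj : j ∈ U then c ⟨j, hj⟩ else 0, fun j hj => by simp [hj], ?_⟩
    rw [← Finset.sum_subset (Finset.subset_univ U) fun j _ hj => by simp [hj],
      ← Finset.sum_coe_sort, ← hc]
    exact Finset.sum_congr rfl fun j _ => by simp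
  obtain ⟨φ, hφ, hle⟩ := Submodule.exists_le_ker_of_lt_top _ hlt
  exact ⟨φ, hφ, fun j hj => hle (Submodule.subset_span ⟨j, hj, rfl⟩)⟩

lemma two_mul_card_ker {V : Type*} [Fintype V] [AddCommGroup V]
    [Module (ZMod 2) V] {φ : Module.Dual (ZMod 2) V} (hφ : φ ≠ 0)
    [DecidablePred fun v => φ v = 0] :
    2 * (Finset.univ.filter fun v => φ v = 0).card = Fintype.card V := by
  obtain ⟨v₀, hv₀⟩ : ∃ v, φ v ≠ 0 := by
    by_contra! h
    exact hφ (LinearMap.ext h)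
  have h2 : ∀ z : ZMod 2, z ≠ 0 → z = 1 := by decide
  have h1 : φ v₀ = 1 := h2 _ hv₀
  have hc : (Finset.univ.filter fun v => φ v = 0).card =
      (Finset.univ.filter fun v => ¬ φ v = 0).card := by
    refine Finset.card_bij (fun v _ => v + v₀) ?_ ?_ ?_
    · intro v hv
      simp only [Finset.mem_filter, Finset.mem_univ, true_and] at hv ⊢
      simp [hv, h1]
    · intro v _ v' _ h
      exact add_right_cancel h
    · intro v hv
      simp only [Finset.mem_filter, Finset.mem_univ, true_and] at hv
      exact ⟨v - v₀, by simp [h2 _ hv, h1], by simp⟩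
  have := Finset.card_filter_add_card_filter_not (s := (Finset.univ : Finset V))
    (fun v => φ v = 0)
  rw [← Finset.card_univ, ← this, ← hc]
  ring

lemma card_not_covers_mul_le {J V : Type*} [Fintype J] [DecidableEq J] [Fintype V]
    [AddCommGroup V] [Module (ZMod 2) V] (U : Finset J)
    [DecidablePred fun G : J → V => ¬ Covers G U] :
    (Finset.univ.filter fun G : J → V => ¬ Covers G U).card * 2 ^ U.card ≤
      Fintype.card V * Fintype.card (J → V) := by
  classical
  let e : V ≃ₗ[ZMod 2] Module.Dual (ZMod 2) V := (Module.finBasis (ZMod 2) V).toDualEquiv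
  let K : V → Finset (J → V) := fun v =>
    Fintype.piFinset fun j => if j ∈ U then Finset.univ.filter fun x => e v x = 0 else Finset.univ
  have hsub : (Finset.univ.filter fun G : J → V => ¬ Covers G U) ⊆
      (Finset.univ.filter fun v : V => v ≠ 0).biUnion K := by
    intro G hG
    obtain ⟨φ, hφ, h⟩ := exists_dual_of_not_covers (Finset.mem_filter.1 hG).2
    refine Finset.mem_biUnion.2 ⟨e.symm φ, by simpa using hφ, ?_⟩
    rw [Fintype.mem_piFinset]
    intro j
    by_cases hj : j ∈ U
    · simp [hj, h j hj]
    · simp [hj]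
  have hK : ∀ v ∈ Finset.univ.filter (fun v : V => v ≠ 0),
      (K v).card * 2 ^ U.card = Fintype.card (J → V) := by
    intro v hv
    have hev : e v ≠ 0 := by simpa using hv
    have h2 : 2 ^ U.card = ∏ j : J, if j ∈ U then 2 else 1 := by
      simp [Finset.prod_ite_mem]
    rw [Fintype.card_piFinset, h2, ← Finset.prod_mul_distrib, Fintype.card_pi]
    refine Finset.prod_congr rfl fun j _ => ?_
    by_cases hj : j ∈ U
    · simp only [hj, if_true]
      rw [mul_comm]
      exact two_mul_card_ker hev
    · simp [hj]
  calc _ ≤ (∑ v ∈ Finset.univ.filter (fun v : V => v ≠ 0), (K v).card) * 2 ^ U.card :=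
        Nat.mul_le_mul_right _ ((Finset.card_le_card hsub).trans Finset.card_biUnion_le)
    _ = ∑ v ∈ Finset.univ.filter (fun v : V => v ≠ 0), Fintype.card (J → V) := by
        rw [Finset.sum_mul]
        exact Finset.sum_congr rfl hK
    _ ≤ _ := by
        rw [Finset.sum_const, smul_eq_mul]
        exact Nat.mul_le_mul_right _ (Finset.card_le_univ _)

/-- Probabilistic method: a family `f` indexed by `ι` can be drawn from `𝓖` so that every
constraint is violated by few members of the family. -/
lemma exists_family_few_bad {𝓖 ι 𝓤 : Type*} [Fintype 𝓖] [Nonempty 𝓖] [Fintype ι]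
    [Nonempty ι] [Fintype 𝓤] (bad : 𝓤 → 𝓖 → Prop) [∀ U, DecidablePred (bad U)]
    (h : ∀ U, (Finset.univ.filter (bad U)).card * Fintype.card ι ≤ Fintype.card 𝓖) :
    ∃ f : ι → 𝓖, ∀ U, 2 ^ (Finset.univ.filter fun i => bad U (f i)).card ≤
      4 * Fintype.card 𝓤 := by
  classical
  let wt : 𝓤 → 𝓖 → ℝ := fun U g => if bad U g then 2 else 1
  have hT : (0 : ℝ) < Fintype.card ι := by exact_mod_cast Fintype.card_pos
  have hwt : ∀ U, (∑ g, wt U g) ^ Fintype.card ι ≤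
      4 * (Fintype.card 𝓖 : ℝ) ^ Fintype.card ι := by
    intro U
    have h1 : ∑ g, wt U g = Fintype.card 𝓖 + (Finset.univ.filter (bad U)).card := by
      have : ∀ g, wt U g = 1 + if bad U g then 1 else 0 := by
        intro g; simp only [wt]; split_ifs <;> norm_num
      simp [this, Finset.sum_add_distrib]
    have h2 : ((Finset.univ.filter (bad U)).card : ℝ) ≤
        Fintype.card 𝓖 * (1 / Fintype.card ι) := by
      rw [mul_one_div, le_div_iff₀ hT]
      exact_mod_cast h U
    have h3 : ∑ g, wt U g ≤ Fintype.card 𝓖 * Real.exp (1 / Fintype.card ι) := by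
      have := Real.add_one_le_exp (1 / (Fintype.card ι : ℝ))
      have h4 : (Fintype.card 𝓖 : ℝ) * (1 / Fintype.card ι + 1) ≤
        Fintype.card 𝓖 * Real.exp (1 / Fintype.card ι) := by gcongr
      rw [h1]
      linarith
    have h0 : 0 ≤ ∑ g, wt U g := by rw [h1]; positivity
    calc _ ≤ ((Fintype.card 𝓖 : ℝ) * Real.exp (1 / Fintype.card ι)) ^ Fintype.card ι := by
          gcongr
      _ = Real.exp 1 * (Fintype.card 𝓖 : ℝ) ^ Fintype.card ι := by
          rw [mul_pow, ← Real.exp_nat_mul, mul_one_div_cancel hT.ne', mul_comm]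
      _ ≤ _ := by
          gcongr
          linarith [Real.exp_one_lt_d9]
  have hsum : ∑ f : ι → 𝓖, ∑ U, ∏ i, wt U (f i) ≤
      ∑ _f : ι → 𝓖, (4 * Fintype.card 𝓤 : ℝ) := by
    rw [Finset.sum_comm]
    calc _ = ∑ U, (∑ g, wt U g) ^ Fintype.card ι := by
          refine Finset.sum_congr rfl fun U _ => ?_
          rw [← Finset.card_univ, ← Finset.prod_const, Finset.prod_univ_sum,
            Fintype.piFinset_univ]
      _ ≤ ∑ _U : 𝓤, 4 * (Fintype.card 𝓖 : ℝ) ^ Fintype.card ι :=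
          Finset.sum_le_sum fun U _ => hwt U
      _ = _ := by
          simp only [Finset.sum_const, Finset.card_univ, nsmul_eq_mul, Fintype.card_fun]
          push_cast
          ring
  obtain ⟨f, -, hf⟩ := Finset.exists_le_of_sum_le Finset.univ_nonempty hsum
  refine ⟨f, fun U => ?_⟩
  have h1 := (Finset.single_le_sum (f := fun U => ∏ i, wt U (f i))
    (fun U _ => Finset.prod_nonneg fun i _ => by simp only [wt]; split_ifs <;> norm_num)
    (Finset.mem_univ U)).trans hf
  have h2 : ∏ i, wt U (f i) = 2 ^ (Finset.univ.filter fun i => bad U (f i)).card := by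
    simp [wt, Finset.prod_ite]
  rw [h2] at h1
  exact_mod_cast h1

/-- A family of random linear hashes: each delivery part is onto, and for every large set `U` of
untapped positions all but few members of the family are onto when restricted to `U`. -/
lemma exists_hash_family {V ι : Type*} [Fintype V] [AddCommGroup V] [Module (ZMod 2) V]
    [Fintype ι] [Nonempty ι] (n K s r : ℕ) (hV : Fintype.card V = 2 ^ K)
    (hι : Fintype.card ι = 2 ^ s) (hr : n ≤ r) (hK : K + 2 + 2 * s + r ≤ 2 * n) :
    ∃ G : ι → Fin n ⊕ Fin n → V, (∀ i, Covers (G i) (Finset.univ.map Function.Embedding.inr)) ∧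
      ∀ U : Finset (Fin n ⊕ Fin n), 2 * n ≤ U.card + s + r →
        ({i | ¬ Covers (G i) U} : Set ι).ncard ≤ 2 * n + 2 := by
  classical
  set U₀ : Finset (Fin n ⊕ Fin n) := Finset.univ.map Function.Embedding.inr with hU₀
  let 𝓖 := {G : Fin n ⊕ Fin n → V // Covers G U₀}
  let 𝓤 := {U : Finset (Fin n ⊕ Fin n) // 2 * n ≤ U.card + s + r}
  set A := Fintype.card (Fin n ⊕ Fin n → V) with hA
  have hA0 : 0 < A := Fintype.card_pos
  have hbad : ∀ (U : Finset (Fin n ⊕ Fin n)) (a : ℕ), K + a ≤ U.card →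
      (Finset.univ.filter fun G : Fin n ⊕ Fin n → V => ¬ Covers G U).card * 2 ^ a ≤ A := by
    intro U a ha
    have h1 := card_not_covers_mul_le (V := V) U
    rw [hV] at h1
    have h2 : 2 ^ K * 2 ^ a ≤ 2 ^ U.card := by
      rw [← pow_add]; exact Nat.pow_le_pow_right (by norm_num) ha
    have h3 : 0 < 2 ^ K := by positivity
    refine Nat.le_of_mul_le_mul_left ?_ h3
    calc _ = (Finset.univ.filter fun G : Fin n ⊕ Fin n → V => ¬ Covers G U).card *
        (2 ^ K * 2 ^ a) := by ring
      _ ≤ _ := (Nat.mul_le_mul_left _ h2).trans h1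
  have h𝓖 : A ≤ 2 * Fintype.card 𝓖 := by
    have h1 := hbad U₀ 1 (by simp [hU₀]; omega)
    have h2 := Finset.card_filter_add_card_filter_not
      (s := (Finset.univ : Finset (Fin n ⊕ Fin n → V))) (fun G => Covers G U₀)
    rw [Finset.card_univ, ← hA] at h2
    rw [Fintype.card_subtype]
    omega
  have : Nonempty 𝓖 := Fintype.card_pos_iff.1 (by omega)
  obtain ⟨f, hf⟩ := exists_family_few_bad (ι := ι) (fun (U : 𝓤) (G : 𝓖) => ¬ Covers G.1 U.1)
    (by
      rintro ⟨U, hU⟩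
      have h1 := hbad U (s + 1) (by omega)
      have h2 : (Finset.univ.filter fun G : 𝓖 => ¬ Covers G.1 U).card ≤
          (Finset.univ.filter fun G : Fin n ⊕ Fin n → V => ¬ Covers G U).card :=
        Finset.card_le_card_of_injOn Subtype.val (fun G hG => by simpa using hG)
          Subtype.val_injective.injOn
      have h3 := (Nat.mul_le_mul_right (2 ^ (s + 1)) h2).trans (h1.trans h𝓖)
      rw [hι]
      rw [pow_succ] at h3
      dsimp only
      linarith)
  refine ⟨fun i => (f i).1, fun i => (f i).2, fun U hU => ?_⟩
  have h1 := hf ⟨U, hU⟩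
  have h2 : Fintype.card 𝓤 ≤ 2 ^ (2 * n) := by
    refine (Fintype.card_subtype_le _).trans ?_
    simp [Fintype.card_finset, two_mul]
  have h3 : 2 ^ (Finset.univ.filter fun i => ¬ Covers (f i).1 U).card ≤ 2 ^ (2 * n + 2) := by
    refine h1.trans ?_
    rw [pow_add]
    omega
  have h4 := (Nat.pow_le_pow_iff_right (by norm_num : 1 < 2)).1 h3
  rwa [Set.ncard_eq_toFinset_card', Set.toFinset_ofPred]

lemma sum_restrict_div {n : ℕ} (P : Finset (Fin n)) (g : ({j // j ∈ P} → ZMod 2) → ℝ) :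
    (∑ x : Fin n → ZMod 2, g fun j => x j) / Fintype.card (Fin n → ZMod 2) =
      (∑ τ, g τ) / Fintype.card ({j // j ∈ P} → ZMod 2) := by
  classical
  let E := Equiv.piEquivPiSubtypeProd (fun j => j ∈ P) (fun _ : Fin n => ZMod 2)
  have hcard : (Fintype.card (Fin n → ZMod 2) : ℝ) =
      Fintype.card ({j // j ∈ P} → ZMod 2) * Fintype.card ({j // j ∉ P} → ZMod 2) := by
    rw [Fintype.card_congr E, Fintype.card_prod]
    push_cast
    rfl
  have hsum : ∑ x : Fin n → ZMod 2, g (fun j => x j) =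
      (∑ τ, g τ) * Fintype.card ({j // j ∉ P} → ZMod 2) := by
    have h1 : ∀ x : Fin n → ZMod 2, g (fun j => x j) = g (E x).1 := fun x => rfl
    simp only [h1]
    rw [Equiv.sum_comp E (fun p => g p.1), Fintype.sum_prod_type, Finset.sum_mul]
    refine Finset.sum_congr rfl fun τ _ => ?_
    dsimp only
    rw [Finset.sum_const, Finset.card_univ, nsmul_eq_mul, mul_comm]
  have h0 : (Fintype.card ({j // j ∉ P} → ZMod 2) : ℝ) ≠ 0 := by
    exact_mod_cast Fintype.card_ne_zero
  rw [hcard, hsum, mul_div_mul_right _ _ h0]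

lemma tap_eq_tap {n : ℕ} {S : Finset (Fin n)} {x y : Fin n → Bool}
    (h : ∀ i ∈ S, x i = y i) : tap S x = tap S y := by
  funext i
  by_cases hi : i ∈ S
  · simp [tap, hi, h i hi]
  · simp [tap, hi]

lemma Code.P_nonneg {D n M C : ℕ} (c : Code D n M C) (ω) : 0 ≤ c.P ω :=
  mul_nonneg (by positivity) (c.q_nonneg _)

lemma Code.sum_P {D n M C : ℕ} (c : Code D n M C) (hM : 1 ≤ M) : ∑ ω, c.P ω = 1 := by
  have hM' : (M : ℝ) ≠ 0 := by positivity
  simp only [Code.P, Fintype.sum_prod_type, ← Finset.mul_sum, c.q_sum]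
  simp [hM']

lemma Code.leak_nonneg {D n M C : ℕ} (c : Code D n M C) (hM : 1 ≤ M) (d S1 S2) :
    0 ≤ c.leak d S1 S2 :=
  mutInfo_nonneg c.P_nonneg (c.sum_P hM) _ _

/-- The coset code: the delivery word solves the linear system, selected by a short public seed
sent in the cache phase, whose right-hand side is the pair of demanded files. -/
lemma exists_coset_code (D n k s r M C : ℕ) (hM : 1 ≤ M) (hMk : M ≤ 2 ^ k)
    (hC : 2 ^ (s + k) ≤ C) (hr : n ≤ r) (hK : 2 * k + 2 + 2 * s + r ≤ 2 * n) :
    ∃ c : Code D n M C, (∀ d, c.errProb d = 0) ∧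
      ∀ d (S1 S2 : Finset (Fin n)), S1.card + S2.card ≤ r →
        c.leak d S1 S2 ≤ (2 * n + 2) / 2 ^ s * Real.log ((M : ℝ) ^ D) := by
  classical
  obtain ⟨P, -, hP⟩ := Finset.exists_subset_card_eq
    (s := (Finset.univ : Finset (Fin n))) (n := s) (by simp; omega)
  let ι := {j // j ∈ P} → ZMod 2
  let V := Fin 2 → Fin k → ZMod 2
  have hι : Fintype.card ι = 2 ^ s := by simp [ι, hP]
  have hV : Fintype.card V = 2 ^ (2 * k) := by simp [V, ← pow_mul, mul_comm]
  obtain ⟨G, hG0, hG⟩ := exists_hash_family (V := V) (ι := ι) n (2 * k) s r hV hι hr hK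
  have hσ : ∀ i : ι, ∀ u : V, ∃ y : Fin n → ZMod 2, ∑ j, y j • G i (Sum.inr j) = u := by
    intro i u
    obtain ⟨v, hv, hu⟩ := hG0 i u
    refine ⟨fun j => v (Sum.inr j), ?_⟩
    rw [← hu, Fintype.sum_sum_type]
    simp [hv]
  choose σ hσ using hσ
  obtain ⟨e⟩ : Nonempty (Fin M ↪ (Fin k → ZMod 2)) :=
    Function.Embedding.nonempty_of_card_le (by simpa using hMk)
  obtain ⟨κ⟩ : Nonempty (ι × (Fin k → ZMod 2) ↪ Fin C) :=
    Function.Embedding.nonempty_of_card_le (by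
      rw [Fintype.card_prod, hι]; simpa [pow_add] using hC)
  have : Nonempty (Fin M) := ⟨⟨0, hM⟩⟩
  let Θ := (Fin n → ZMod 2) × (Fin n → ZMod 2)
  obtain ⟨nr, ⟨E⟩⟩ : ∃ nr, Nonempty (Fin (nr + 1) ≃ Θ) := by
    refine ⟨Fintype.card Θ - 1, ⟨(Fintype.equivFinOfCardEq ?_).symm⟩⟩
    have : 0 < Fintype.card Θ := Fintype.card_pos
    omega
  let β : ZMod 2 ≃ Bool := finTwoEquiv
  let seed : (Fin n → ZMod 2) → ι := fun x j => x j
  let A : ι → (Fin n → ZMod 2) → V := fun i x => ∑ j, x j • G i (Sum.inl j)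
  let B : ι → (Fin n → ZMod 2) → V := fun i y => ∑ j, y j • G i (Sum.inr j)
  have hAadd : ∀ i x x', A i (x + x') = A i x + A i x' := fun i x x' => by
    simp [A, add_smul, Finset.sum_add_distrib]
  have hBadd : ∀ i x x', B i (x + x') = B i x + B i x' := fun i x x' => by
    simp [B, add_smul, Finset.sum_add_distrib]
  have hBsub : ∀ i x x', B i (x - x') = B i x - B i x' := fun i x x' => by
    simp [B, sub_smul, Finset.sum_sub_distrib]
  let tgt : Fin D × Fin D → (Fin D → Fin M) → V := fun d w =>
    ![e (w d.1), e (w d.2)]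
  let del : Fin D × Fin D → (Fin D → Fin M) → Θ → Fin n → ZMod 2 := fun d w θ =>
    θ.2 - σ (seed θ.1) (A (seed θ.1) θ.1 + B (seed θ.1) θ.2 - tgt d w)
  have hdel : ∀ d w θ, A (seed θ.1) θ.1 + B (seed θ.1) (del d w θ) = tgt d w := by
    intro d w θ
    have h1 : ∀ i u, B i (σ i u) = u := hσ
    simp only [del]
    rw [hBsub, h1]
    abel
  let c : Code D n M C :=
    { nr := nr
      q := fun _ => 1 / Fintype.card Θ
      q_nonneg := fun _ => by positivity
      q_sum := by
        have h0 : (Fintype.card Θ : ℝ) ≠ 0 := by exact_mod_cast Fintype.card_ne_zero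
        rw [Finset.sum_const, Finset.card_univ, Fintype.card_congr E, nsmul_eq_mul]
        field_simp
      encC := fun _ θ => β ∘ (E θ).1
      cacheF := fun b X => κ (seed (β.symm ∘ X), A (seed (β.symm ∘ X)) (β.symm ∘ X) b)
      encD := fun d w θ => β ∘ del d w (E θ)
      dec := fun _ b m X => Function.invFun e
        ((Function.invFun κ m).2 + B (Function.invFun κ m).1 (β.symm ∘ X) b) }
  have hβ : ∀ x : Fin n → ZMod 2, β.symm ∘ (β ∘ x) = x := fun x => by
    funext j; simp
  have hdec : ∀ d b w θ, c.dec d b (c.cacheF b (c.encC w θ)) (c.encD d w θ) =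
      Function.invFun e (tgt d w b) := by
    intro d b w θ
    simp only [c, hβ, Function.leftInverse_invFun κ.injective _]
    rw [← hdel d w (E θ)]
    rfl
  refine ⟨c, fun d => ?_, fun d S1 S2 hS => ?_⟩
  · refine Finset.sum_eq_zero fun ω _ => if_neg ?_
    rw [hdec, hdec]
    simp [tgt, Function.leftInverse_invFun e.injective _]
  set U : Finset (Fin n ⊕ Fin n) := ((S1 ∪ P).disjSum S2)ᶜ with hU
  have hUcard : 2 * n ≤ U.card + s + r := by
    have h1 := Finset.card_union_le S1 P
    rw [hU, Finset.card_compl, Finset.card_disjSum]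
    simp only [Fintype.card_sum, Fintype.card_fin]
    omega
  have hv : ∀ w w' : Fin D → Fin M, ∀ i : ι, ∃ v : Fin n ⊕ Fin n → ZMod 2,
      (∀ j, j ∉ U → v j = 0) ∧ (Covers (G i) U →
        A i (fun j => v (Sum.inl j)) + B i (fun j => v (Sum.inr j)) = tgt d w' - tgt d w) := by
    intro w w' i
    by_cases h : Covers (G i) U
    · obtain ⟨v, hv, hu⟩ := h (tgt d w' - tgt d w)
      refine ⟨v, hv, fun _ => ?_⟩
      rw [← hu, Fintype.sum_sum_type]
    · exact ⟨0, fun _ _ => rfl, fun h' => absurd h' h⟩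
  have hleak := mutInfo_le_of_shift (W := Fin D → Fin M) c.q c.q_nonneg c.q_sum ((M : ℝ) ^ D)
    (by simp) (fun w θ => (tap S1 (c.encC w θ), tap S2 (c.encD d w θ)))
    (fun θ => Covers (G (seed (E θ).1)) U) (by
      intro w w'
      choose v hvU hvs using hv w w'
      have hseed : ∀ i x, seed (x + fun j => v i (Sum.inl j)) = seed x := by
        intro i x
        funext j
        have : v i (Sum.inl j.1) = 0 := hvU i _ (by simp [hU, j.2])
        simp [seed, this]
      have hseed' : ∀ i x, seed (x - fun j => v i (Sum.inl j)) = seed x := by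
        intro i x
        rw [← hseed i, sub_add_cancel]
      let ψ : Θ ≃ Θ :=
        { toFun := fun θ => (θ.1 + fun j => v (seed θ.1) (Sum.inl j),
            θ.2 + fun j => v (seed θ.1) (Sum.inr j))
          invFun := fun θ => (θ.1 - fun j => v (seed θ.1) (Sum.inl j),
            θ.2 - fun j => v (seed θ.1) (Sum.inr j))
          left_inv := fun θ => by simp [hseed]
          right_inv := fun θ => by simp [hseed'] }
      refine ⟨(E.trans ψ).trans E.symm, fun θ => ⟨rfl, ?_, fun hg => ?_⟩⟩
      · simp [ψ, hseed]
      · set x := (E θ).1 with hx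
        set y := (E θ).2 with hy
        have hd : del d w' (ψ (E θ)) = del d w (E θ) + fun j => v (seed x) (Sum.inr j) := by
          simp only [del, ψ, Equiv.coe_fn_mk, hseed, ← hx, ← hy, hAadd, hBadd]
          have : A (seed x) x + A (seed x) (fun j => v (seed x) (Sum.inl j)) +
              (B (seed x) y + B (seed x) fun j => v (seed x) (Sum.inr j)) - tgt d w' =
              A (seed x) x + B (seed x) y - tgt d w := by
            have := hvs (seed x) hg
            rw [eq_sub_iff_add_eq] at this
            rw [← this]
            abel
          rw [this]
          abel
        refine Prod.ext (tap_eq_tap fun j hj => ?_) (tap_eq_tap fun j hj => ?_)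
        · have : v (seed x) (Sum.inl j) = 0 := hvU _ _ (by simp [hU, hj])
          simp [c, ψ, ← hx, this]
        · have : v (seed x) (Sum.inr j) = 0 := hvU _ _ (by simp [hU, hj])
          simp [c, hd, this])
  refine hleak.trans (mul_le_mul_of_nonneg_right ?_ (Real.log_nonneg ?_))
  · have h1 : (∑ θ, if Covers (G (seed (E θ).1)) U then 0 else c.q θ) =
        (∑ x : Fin n → ZMod 2, if Covers (G (seed x)) U then (0 : ℝ) else 1) /
          Fintype.card (Fin n → ZMod 2) := by
      have h2 := Equiv.sum_comp E fun θ : Θ =>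
        if Covers (G (seed θ.1)) U then (0 : ℝ) else 1 / Fintype.card Θ
      have h0 : (Fintype.card (Fin n → ZMod 2) : ℝ) ≠ 0 := by
        exact_mod_cast Fintype.card_ne_zero
      refine h2.trans ?_
      rw [Fintype.sum_prod_type, Finset.sum_div]
      refine Finset.sum_congr rfl fun x _ => ?_
      by_cases h : Covers (G (seed x)) U
      · simp [h]
      · simp only [h, if_false, Finset.sum_const, Finset.card_univ, nsmul_eq_mul, Θ,
          Fintype.card_prod, Nat.cast_mul]
        field_simp
    have h3 := sum_restrict_div P fun τ : ι => if Covers (G τ) U then (0 : ℝ) else 1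
    have h4 := hG U hUcard
    rw [Set.ncard_eq_toFinset_card', Set.toFinset_ofPred] at h4
    have h5 : (∑ τ : ι, if Covers (G τ) U then (0 : ℝ) else 1) ≤ 2 * n + 2 := by
      have : (∑ τ : ι, if Covers (G τ) U then (0 : ℝ) else 1) =
          (Finset.univ.filter fun τ : ι => ¬ Covers (G τ) U).card := by
        rw [Finset.card_filter]
        push_cast
        exact Finset.sum_congr rfl fun τ _ => by by_cases h : Covers (G τ) U <;> simp [h]
      rw [this]
      exact_mod_cast h4
    rw [h1]
    refine h3.le.trans ?_
    have h6 : (Fintype.card ({j // j ∈ P} → ZMod 2) : ℝ) = 2 ^ s := by exact_mod_cast hι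
    rw [h6]
    gcongr
  · exact one_le_pow₀ (by exact_mod_cast hM)

lemma card_tap_eq_le {n : ℕ} (S : Finset (Fin n)) (z : Fin n → Option Bool) :
    (Finset.univ.filter fun x : Fin n → Bool => tap S x = z).card ≤ 2 ^ (n - S.card) := by
  classical
  have h1 : Fintype.card ({j // j ∈ Sᶜ} → Bool) = 2 ^ (n - S.card) := by
    simp
  rw [← h1, ← Finset.card_univ]
  refine Finset.card_le_card_of_injOn (fun x j => x j) (fun _ _ => Finset.mem_coe.2
    (Finset.mem_univ _)) ?_
  intro x hx y hy hxy
  have hx' : tap S x = z := (Finset.mem_filter.1 hx).2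
  have hy' : tap S y = z := (Finset.mem_filter.1 hy).2
  funext j
  by_cases hj : j ∈ S
  · have := congrFun (hx'.trans hy'.symm) j
    simpa [tap, hj] using this
  · exact congrFun hxy ⟨j, by simpa using hj⟩

lemma card_two_values_mul {D M : ℕ} {i j : Fin D} (hij : i ≠ j) (a b : Fin M) :
    (Finset.univ.filter fun w : Fin D → Fin M => a = w i ∧ b = w j).card * M ^ 2 = M ^ D := by
  classical
  have h1 : (Finset.univ.filter fun w : Fin D → Fin M => a = w i ∧ b = w j) =
      Fintype.piFinset fun l => if l = i then {a} else if l = j then {b} else Finset.univ := by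
    ext w
    simp only [Finset.mem_filter, Finset.mem_univ, true_and, Fintype.mem_piFinset]
    constructor
    · rintro ⟨rfl, rfl⟩ l
      by_cases h : l = i
      · simp [h]
      · by_cases h' : l = j <;> simp [h, h', hij.symm]
    · intro h
      have hi := h i
      have hj := h j
      simp [hij.symm] at hi hj
      exact ⟨hi.symm, hj.symm⟩
  have h2 : M ^ 2 = ∏ l : Fin D, (if l = i then M else 1) * (if l = j then M else 1) := by
    rw [Finset.prod_mul_distrib, sq]
    simp
  rw [h1, Fintype.card_piFinset, h2, ← Finset.prod_mul_distrib]
  have h3 : M ^ D = ∏ _l : Fin D, M := by simp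
  rw [h3]
  refine Finset.prod_congr rfl fun l _ => ?_
  by_cases h : l = i
  · simp [h, hij]
  · by_cases h' : l = j <;> simp [h, h', hij.symm]

/-- Finite-blocklength converse: decoding both files from the two transmissions forces the
entropy of the pair beyond the untapped bits to leak. -/
lemma Code.le_leak {D n M C : ℕ} (c : Code D n M C) (hM : 1 ≤ M) (d : Fin D × Fin D)
    (hd : d.1 ≠ d.2) (S1 S2 : Finset (Fin n)) :
    (1 - c.errProb d) * (2 * Real.log M -
      ((n - S1.card : ℕ) + (n - S2.card : ℕ)) * Real.log 2) - Real.log 2 ≤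
      c.leak d S1 S2 := by
  classical
  set u : ℕ := (n - S1.card) + (n - S2.card) with hu
  set N : ℝ := (M : ℝ) ^ D with hN
  have hM0 : (0 : ℝ) < M := by exact_mod_cast hM
  have hN0 : 0 < N := by positivity
  let dc : (Fin n → Bool) × (Fin n → Bool) → Fin M × Fin M := fun x =>
    (c.dec d 0 (c.cacheF 0 x.1) x.2, c.dec d 1 (c.cacheF 1 x.1) x.2)
  let T : (Fin n → Option Bool) × (Fin n → Option Bool) →
      Finset ((Fin n → Bool) × (Fin n → Bool)) := fun z =>
    (Finset.univ.filter fun x => tap S1 x = z.1) ×ˢ (Finset.univ.filter fun x => tap S2 x = z.2)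
  have hT : ∀ z, ((T z).card : ℝ) ≤ 2 ^ u := by
    intro z
    rw [Finset.card_product, hu, pow_add]
    push_cast
    have h1 := card_tap_eq_le S1 z.1
    have h2 := card_tap_eq_le S2 z.2
    gcongr
    · exact_mod_cast h1
    · exact_mod_cast h2
  let F : (Fin D → Fin M) → (Fin n → Bool) × (Fin n → Bool) → ℝ := fun w x =>
    if (dc x).1 = w d.1 ∧ (dc x).2 = w d.2 then 1 else 0
  have hF0 : ∀ w x, 0 ≤ F w x := fun w x => by simp only [F]; split_ifs <;> norm_num
  have hFs : ∀ x, ∑ w, F w x * M ^ 2 = N := by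
    intro x
    have := card_two_values_mul hd (dc x).1 (dc x).2
    rw [← Finset.sum_mul, hN]
    simp only [F, Finset.sum_boole]
    exact_mod_cast this
  let Q : (Fin D → Fin M) → (Fin n → Option Bool) × (Fin n → Option Bool) → ℝ := fun w z =>
    1 / 2 * (1 / N + ∑ x ∈ T z, F w x * M ^ 2 / (N * 2 ^ u))
  have hS0 : ∀ w z, 0 ≤ ∑ x ∈ T z, F w x * M ^ 2 / (N * 2 ^ u) := fun w z =>
    Finset.sum_nonneg fun x _ => by have := hF0 w x; positivity
  have hQ0 : ∀ w z, 0 < Q w z := fun w z => by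
    have := hS0 w z
    simp only [Q]
    positivity
  have hQ1 : ∀ z, ∑ w, Q w z ≤ 1 := by
    intro z
    simp only [Q]
    rw [← Finset.mul_sum, Finset.sum_add_distrib, Finset.sum_comm]
    have h1 : ∑ _w : Fin D → Fin M, 1 / N = 1 := by
      simp only [Finset.sum_const, Finset.card_univ, nsmul_eq_mul, hN]
      simp [hM0.ne']
    have h2 : ∑ x ∈ T z, ∑ w, F w x * M ^ 2 / (N * 2 ^ u) ≤ 1 := by
      simp only [← Finset.sum_div, hFs, Finset.sum_const, nsmul_eq_mul]
      rw [div_le_one (by positivity)]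
      have := hT z
      rw [mul_comm]
      gcongr
    rw [h1]
    linarith
  have hmain := sum_mul_log_le_mutInfo c.P_nonneg (fun ω => ω.1)
    (fun ω => (tap S1 (c.encC ω.1 ω.2), tap S2 (c.encD d ω.1 ω.2))) Q (fun ω _ => hQ0 _ _)
    (fun a b => (hQ0 a b).le) hQ1
  refine le_trans ?_ hmain
  have hdist : ∀ w, CBC.dist c.P (fun ω => ω.1) w = 1 / N := by
    intro w
    simp only [CBC.dist, Fintype.sum_prod_type, Code.P]
    rw [Finset.sum_eq_single w]
    · simp [← Finset.mul_sum, c.q_sum, hN]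
    · intro w' _ h; simp [h]
    · simp
  set L : ℝ := 2 * Real.log M - ((n - S1.card : ℕ) + (n - S2.card : ℕ)) * Real.log 2 with hL
  let err : (Fin D → Fin M) × Fin (c.nr + 1) → Prop := fun ω =>
    c.dec d 0 (c.cacheF 0 (c.encC ω.1 ω.2)) (c.encD d ω.1 ω.2) ≠ ω.1 d.1 ∨
    c.dec d 1 (c.cacheF 1 (c.encC ω.1 ω.2)) (c.encD d ω.1 ω.2) ≠ ω.1 d.2
  have herr : c.errProb d = ∑ ω, if err ω then c.P ω else 0 := rfl
  have hlhs : (1 - c.errProb d) * L - Real.log 2 =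
      ∑ ω, c.P ω * ((if err ω then 0 else L) - Real.log 2) := by
    simp only [mul_sub, Finset.sum_sub_distrib, ← Finset.sum_mul, c.sum_P hM, one_mul]
    congr 1
    nth_rewrite 1 [herr, ← c.sum_P hM]
    rw [← Finset.sum_sub_distrib, Finset.sum_mul]
    refine Finset.sum_congr rfl fun ω _ => ?_
    by_cases h : err ω <;> simp [h]
  rw [hlhs]
  refine Finset.sum_le_sum fun ω _ => mul_le_mul_of_nonneg_left ?_ (c.P_nonneg ω)
  rw [hdist]
  set z := (tap S1 (c.encC ω.1 ω.2), tap S2 (c.encD d ω.1 ω.2)) with hz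
  have hQN : Q ω.1 z / (1 / N) = 1 / 2 * (1 + (∑ x ∈ T z, F ω.1 x) * M ^ 2 / 2 ^ u) := by
    simp only [Q, ← Finset.sum_div, ← Finset.sum_mul]
    field_simp
  have hs0 : 0 ≤ ∑ x ∈ T z, F ω.1 x := Finset.sum_nonneg fun x _ => hF0 _ x
  rw [hQN]
  by_cases h : err ω
  · simp only [h, if_true, zero_sub]
    rw [← Real.log_inv]
    apply Real.log_le_log (by norm_num)
    have : 0 ≤ (∑ x ∈ T z, F ω.1 x) * (M : ℝ) ^ 2 / 2 ^ u := by positivity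
    linarith
  · simp only [h, if_false]
    have h1 : 1 ≤ ∑ x ∈ T z, F ω.1 x := by
      have hmem : (c.encC ω.1 ω.2, c.encD d ω.1 ω.2) ∈ T z := by simp [T, hz]
      have := Finset.single_le_sum (f := F ω.1) (fun x _ => hF0 _ x) hmem
      refine le_trans (le_of_eq ?_) this
      simp only [err, not_or, not_not] at h
      simp [F, dc, h.1, h.2]
    have h2 : L - Real.log 2 = Real.log (1 / 2 * (M ^ 2 / 2 ^ u)) := by
      rw [Real.log_mul (by norm_num) (by positivity), Real.log_div (x := (M : ℝ) ^ 2)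
        (by positivity) (by positivity), Real.log_pow, Real.log_pow, one_div, Real.log_inv, hL, hu]
      push_cast
      ring
    rw [h2]
    apply Real.log_le_log (by positivity)
    have h3 : (M : ℝ) ^ 2 / 2 ^ u ≤ (∑ x ∈ T z, F ω.1 x) * M ^ 2 / 2 ^ u := by
      gcongr
      exact le_mul_of_one_le_left (by positivity) h1
    linarith

lemma Achievable.le {D : ℕ} (hD : 2 ≤ D) {α R : ℝ} (h1 : 1 ≤ α) (h2 : α ≤ 2)
    (h : Achievable D α R) : R ≤ 1 - α / 2 := by
  obtain ⟨c, ε, δ, hε, hδ, herr, hleak⟩ := h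
  by_contra! hR
  set γ : ℝ := 2 * R - 2 + α with hγ
  have hγ0 : 0 < γ := by rw [hγ]; linarith
  have hR0 : 0 ≤ R := by linarith
  have hl2 : 0 < Real.log 2 := Real.log_pos (by norm_num)
  have hlin : ∀ᶠ n : ℕ in atTop, 5 + 3 * Real.log 2 ≤ n * (γ * Real.log 2) :=
    (tendsto_natCast_atTop_atTop.atTop_mul_const (by positivity)).eventually_ge_atTop _
  obtain ⟨n, hn1, hn2, hn3⟩ := ((hε.eventually_le_const (by norm_num : (0 : ℝ) < 1 / 2)).and
    ((hδ.eventually_le_const (by norm_num : (0 : ℝ) < 1)).and hlin)).exists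
  have hpow : (1 : ℝ) ≤ 2 ^ ((n : ℝ) * R) :=
    Real.one_le_rpow (by norm_num) (by positivity)
  have hM : 1 ≤ msgCount n R := Nat.le_floor (by simpa using hpow)
  have hM' : (2 : ℝ) ^ ((n : ℝ) * R) ≤ 2 * msgCount n R := by
    have := (Nat.lt_floor_add_one ((2 : ℝ) ^ ((n : ℝ) * R))).le
    have h4 : (1 : ℝ) ≤ msgCount n R := by exact_mod_cast hM
    unfold msgCount at h4 ⊢
    linarith
  have hlogM : n * R * Real.log 2 - Real.log 2 ≤ Real.log (msgCount n R) := by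
    have h4 := Real.log_le_log (by positivity) hM'
    rw [Real.log_rpow (by norm_num), Real.log_mul (by norm_num) (by positivity)] at h4
    linarith
  have hn0 : (0 : ℝ) ≤ n := by positivity
  have hfl1 : n ≤ ⌊α * n⌋₊ := Nat.le_floor (by nlinarith)
  have hfl2 : ⌊α * n⌋₊ ≤ 2 * n := Nat.floor_le_of_le (by push_cast; nlinarith)
  obtain ⟨S2, -, hS2⟩ := Finset.exists_subset_card_eq
    (s := (Finset.univ : Finset (Fin n))) (n := ⌊α * n⌋₊ - n) (by simp; omega)
  let d : Fin D × Fin D := (⟨0, by omega⟩, ⟨1, by omega⟩)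
  have hd : d.1 ≠ d.2 := by simp [d]
  have hkey := (c n).le_leak hM d hd Finset.univ S2
  have hle := (le_abs_self _).trans (hleak n d Finset.univ S2 (by
    have h5 := Nat.floor_le (by positivity : 0 ≤ α * n)
    dsimp only
    rw [hS2, Nat.cast_sub hfl1]
    simpa using h5))
  have he := herr n d
  have hu : (((n - (Finset.univ : Finset (Fin n)).card : ℕ) : ℝ) + (n - S2.card : ℕ)) ≤
      2 * n - α * n + 1 := by
    have h6 : n - (⌊α * n⌋₊ - n) = 2 * n - ⌊α * n⌋₊ := by omega
    have h7 := (Nat.lt_floor_add_one (α * n)).le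
    rw [hS2, h6, Nat.cast_sub hfl2]
    simp
    linarith
  set L := 2 * Real.log (msgCount n R) -
    (((n - (Finset.univ : Finset (Fin n)).card : ℕ) : ℝ) + (n - S2.card : ℕ)) * Real.log 2
    with hL
  have hL5 : 5 ≤ L := by
    have := mul_le_mul_of_nonneg_right hu hl2.le
    rw [hL]
    rw [hγ] at hn3
    nlinarith
  have : 1 / 2 * L ≤ (1 - (c n).errProb d) * L := by
    gcongr
    linarith
  have := Real.log_two_lt_d9
  linarith

lemma msgCount_pos {R : ℝ} (hR : 0 ≤ R) (n : ℕ) : 1 ≤ msgCount n R :=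
  Nat.le_floor (by
    simpa using Real.one_le_rpow (by norm_num : (1 : ℝ) ≤ 2) (by positivity : 0 ≤ (n : ℝ) * R))

lemma exists_code_of_pos (D n : ℕ) {M C : ℕ} (hM : 1 ≤ M) (hC : 1 ≤ C) :
    Nonempty (Code D n M C) :=
  ⟨{ nr := 0
     q := fun _ => 1
     q_nonneg := fun _ => zero_le_one
     q_sum := by simp
     encC := fun _ _ _ => false
     cacheF := fun _ _ => ⟨0, hC⟩
     encD := fun _ _ _ _ => false
     dec := fun _ _ _ _ => ⟨0, hM⟩ }⟩

lemma cacheSize_pos (n : ℕ) : 1 ≤ cacheSize n :=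
  Nat.le_floor (by
    simpa using Real.one_le_rpow (by norm_num : (1 : ℝ) ≤ 2) (by positivity : 0 ≤ (n : ℝ) / 2))

lemma achievable_of_eventually {D : ℕ} {α R : ℝ} (hR : 0 ≤ R) (δ : ℕ → ℝ)
    (hδ : Tendsto δ atTop (nhds 0))
    (h : ∀ᶠ n in atTop, ∃ c : Code D n (msgCount n R) (cacheSize n), (∀ d, c.errProb d = 0) ∧
      ∀ d (S1 S2 : Finset (Fin n)), ((S1.card : ℝ) + S2.card) ≤ α * n →
        c.leak d S1 S2 ≤ δ n) : Achievable D α R := by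
  classical
  obtain ⟨n₀, hn₀⟩ := eventually_atTop.1 h
  have hc : ∀ n, ∃ c : Code D n (msgCount n R) (cacheSize n), n₀ ≤ n →
      (∀ d, c.errProb d = 0) ∧ ∀ d (S1 S2 : Finset (Fin n)),
        ((S1.card : ℝ) + S2.card) ≤ α * n → c.leak d S1 S2 ≤ δ n := by
    intro n
    by_cases hn : n₀ ≤ n
    · obtain ⟨c, hc⟩ := hn₀ n hn
      exact ⟨c, fun _ => hc⟩
    · obtain ⟨c⟩ := exists_code_of_pos D n (msgCount_pos hR n) (cacheSize_pos n)
      exact ⟨c, fun h => absurd h hn⟩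
  choose c hc using hc
  have herr0 : ∀ n d, 0 ≤ (c n).errProb d := fun n d =>
    Finset.sum_nonneg fun ω _ => by
      have := (c n).P_nonneg ω
      split_ifs <;> simp [this]
  refine ⟨c, fun n => ∑ d, (c n).errProb d, fun n => if n₀ ≤ n then δ n else
    ∑ d, ∑ S1, ∑ S2, |(c n).leak d S1 S2|, ?_, ?_, fun n d => ?_, fun n d S1 S2 hS => ?_⟩
  · refine tendsto_const_nhds.congr' ?_
    filter_upwards [eventually_ge_atTop n₀] with n hn
    simp [(hc n hn).1]
  · refine hδ.congr' ?_
    filter_upwards [eventually_ge_atTop n₀] with n hn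
    simp [hn]
  · exact Finset.single_le_sum (f := fun d => (c n).errProb d) (fun d _ => herr0 n d)
      (Finset.mem_univ d)
  · by_cases hn : n₀ ≤ n
    · simp only [hn, if_true]
      rw [abs_of_nonneg ((c n).leak_nonneg (msgCount_pos hR n) d S1 S2)]
      exact (hc n hn).2 d S1 S2 hS
    · simp only [hn, if_false]
      refine (Finset.single_le_sum (f := fun S2 => |(c n).leak d S1 S2|)
        (fun _ _ => abs_nonneg _) (Finset.mem_univ S2)).trans ?_
      refine (Finset.single_le_sum (f := fun S1 => ∑ S2, |(c n).leak d S1 S2|)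
        (fun _ _ => Finset.sum_nonneg fun _ _ => abs_nonneg _) (Finset.mem_univ S1)).trans ?_
      exact Finset.single_le_sum (f := fun d => ∑ S1, ∑ S2, |(c n).leak d S1 S2|)
        (fun _ _ => Finset.sum_nonneg fun _ _ => Finset.sum_nonneg fun _ _ => abs_nonneg _)
        (Finset.mem_univ d)

lemma achievable_zero (D : ℕ) (α : ℝ) : Achievable D α 0 := by
  classical
  refine achievable_of_eventually le_rfl (fun _ => 0) tendsto_const_nhds
    (Eventually.of_forall fun n => ?_)
  have h1 : msgCount n 0 = 1 := by simp [msgCount]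
  rw [h1]
  obtain ⟨c⟩ := exists_code_of_pos D n le_rfl (cacheSize_pos n)
  refine ⟨c, fun d => ?_, fun d S1 S2 _ => ?_⟩
  · exact Finset.sum_eq_zero fun ω _ => if_neg (by
      simp [eq_iff_true_of_subsingleton])
  · have := mutInfo_le_of_shift c.q c.q_nonneg c.q_sum (((1 : ℕ) : ℝ) ^ D) (by simp)
      (fun w θ => (tap S1 (c.encC w θ), tap S2 (c.encD d w θ))) (fun _ => True)
      (fun w w' => ⟨Equiv.refl _, fun θ => ⟨rfl, Iff.rfl, fun _ => by
        rw [Subsingleton.elim w w']; rfl⟩⟩)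
    exact this.trans (by simp)

lemma achievable_of_lt {D : ℕ} {α R : ℝ} (h1 : 1 ≤ α) (hR : 0 ≤ R) (hlt : R < 1 - α / 2) :
    Achievable D α R := by
  set γ : ℝ := (1 - α / 2 - R) / 2 with hγ
  have hγ0 : 0 < γ := by rw [hγ]; linarith
  set ρ : ℝ := 2 ^ (-γ) with hρ
  have hρ0 : 0 < ρ := by positivity
  have hρ1 : ρ < 1 := Real.rpow_lt_one_of_one_lt_of_neg (by norm_num) (by linarith)
  have hρabs : |ρ| < 1 := by rwa [abs_of_pos hρ0]
  have hδ : Tendsto (fun n : ℕ => 4 * (D : ℝ) * ((n : ℝ) ^ 2 * ρ ^ n) +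
      4 * (D : ℝ) * ((n : ℝ) ^ 1 * ρ ^ n)) atTop (nhds 0) := by
    have ha := (tendsto_pow_const_mul_const_pow_of_abs_lt_one 2 hρabs).const_mul (4 * (D : ℝ))
    have hb := (tendsto_pow_const_mul_const_pow_of_abs_lt_one 1 hρabs).const_mul (4 * (D : ℝ))
    simpa using ha.add hb
  refine achievable_of_eventually hR _ hδ ?_
  have hlin : ∀ᶠ n : ℕ in atTop, 2 ≤ n * γ :=
    (tendsto_natCast_atTop_atTop.atTop_mul_const hγ0).eventually_ge_atTop _
  filter_upwards [hlin] with n hn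
  have hn0 : (0 : ℝ) ≤ n := by positivity
  have hk1 := (Nat.ceil_lt_add_one (by positivity : 0 ≤ (n : ℝ) * R)).le
  have hs1 := Nat.floor_le (by positivity : 0 ≤ (n : ℝ) * γ)
  have hr1 := Nat.floor_le (by positivity : 0 ≤ α * n)
  have hr : n ≤ ⌊α * n⌋₊ := Nat.le_floor (by nlinarith)
  have hK : 2 * ⌈(n : ℝ) * R⌉₊ + 2 + 2 * ⌊(n : ℝ) * γ⌋₊ + ⌊α * n⌋₊ ≤ 2 * n := by
    have : (2 * ⌈(n : ℝ) * R⌉₊ + 2 + 2 * ⌊(n : ℝ) * γ⌋₊ + ⌊α * n⌋₊ : ℝ) ≤ 2 * n := by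
      have h4 : (n : ℝ) * R = n - α * n / 2 - 2 * (n * γ) := by rw [hγ]; ring
      linarith
    exact_mod_cast this
  set k := ⌈(n : ℝ) * R⌉₊
  set s := ⌊(n : ℝ) * γ⌋₊ with hs
  have hMk' : (msgCount n R : ℝ) ≤ 2 ^ ((n : ℝ) * R) := Nat.floor_le (by positivity)
  have hMk : msgCount n R ≤ 2 ^ k := by
    have : (msgCount n R : ℝ) ≤ 2 ^ k := by
      refine hMk'.trans ?_
      rw [← Real.rpow_natCast]
      exact Real.rpow_le_rpow_of_exponent_le (by norm_num) (Nat.le_ceil _)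
    exact_mod_cast this
  have hC : 2 ^ (s + k) ≤ cacheSize n := by
    refine Nat.le_floor ?_
    push_cast
    rw [← Real.rpow_natCast]
    refine Real.rpow_le_rpow_of_exponent_le (by norm_num) ?_
    have h5 : 2 * (s + k) ≤ n := by omega
    have h6 : (2 : ℝ) * ((s + k : ℕ) : ℝ) ≤ n := by exact_mod_cast h5
    linarith
  obtain ⟨c, hc1, hc2⟩ := exists_coset_code D n k s ⌊α * n⌋₊ (msgCount n R) (cacheSize n)
    (msgCount_pos hR n) hMk hC hr hK
  refine ⟨c, hc1, fun d S1 S2 hS => (hc2 d S1 S2 (Nat.le_floor (by push_cast; exact hS))).trans ?_⟩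
  have hM1 : (1 : ℝ) ≤ msgCount n R := by exact_mod_cast msgCount_pos hR n
  have hlog : Real.log ((msgCount n R : ℝ) ^ D) ≤ D * n := by
    rw [Real.log_pow]
    have h7 := Real.log_le_log (by positivity) hMk'
    rw [Real.log_rpow (by norm_num)] at h7
    have h8 := Real.log_two_lt_d9
    have h9 : 0 < Real.log 2 := Real.log_pos (by norm_num)
    have h10 : (n : ℝ) * R * Real.log 2 ≤ n := by
      have : R * Real.log 2 ≤ 1 := by nlinarith
      nlinarith
    gcongr
    linarith
  have hpow : (1 : ℝ) / 2 ^ s ≤ 2 * ρ ^ n := by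
    have h11 : ρ ^ n = 2 ^ (-(n * γ)) := by
      rw [hρ, ← Real.rpow_natCast, ← Real.rpow_mul (by norm_num)]
      congr 1
      ring
    have h12 : (1 : ℝ) / 2 ^ s = 2 ^ (-(s : ℝ)) := by
      rw [Real.rpow_neg (by norm_num), Real.rpow_natCast, one_div]
    have h13 : (2 : ℝ) * 2 ^ (-(n * γ)) = 2 ^ (1 + -(n * γ)) := by
      rw [Real.rpow_add (by norm_num), Real.rpow_one]
    rw [h11, h12, h13]
    refine Real.rpow_le_rpow_of_exponent_le (by norm_num) ?_
    have := (Nat.lt_floor_add_one ((n : ℝ) * γ)).le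
    rw [← hs] at this
    linarith
  calc (2 * (n : ℝ) + 2) / 2 ^ s * Real.log ((msgCount n R : ℝ) ^ D)
      = (2 * (n : ℝ) + 2) * (1 / 2 ^ s) * Real.log ((msgCount n R : ℝ) ^ D) := by ring
    _ ≤ (2 * (n : ℝ) + 2) * (2 * ρ ^ n) * (D * n) := by
        gcongr
        exact Real.log_nonneg (one_le_pow₀ hM1)
    _ = _ := by ring

end CBC

open CBC in
/-- **Corollary 1.** For every tapped ratio `1 ≤ α ≤ 2` (the adversary can tap
longer than one full phase of communication) and every library size `D ≥ 2`,
the strong secrecy capacity of the CBC-WCT II equals `1 - α/2`. -/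
theorem strong_secrecy_capacity_alpha_ge_one (D : ℕ) (hD : 2 ≤ D)
    (α : ℝ) (h1 : 1 ≤ α) (h2 : α ≤ 2) :
    capacity D α = 1 - α / 2 := by
  have hbdd : BddAbove {R : ℝ | Achievable D α R} :=
    ⟨1 - α / 2, fun R hR => Achievable.le hD h1 h2 hR⟩
  refine le_antisymm (csSup_le ⟨0, achievable_zero D α⟩ fun R hR => Achievable.le hD h1 h2 hR) ?_
  have h0 : 0 ≤ capacity D α := le_csSup hbdd (achievable_zero D α)
  refine le_of_forall_lt fun b hb => ?_
  rcases lt_or_ge b 0 with hb0 | hb0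
  · exact hb0.trans_le h0
  · exact lt_of_lt_of_le (by linarith : b < (b + (1 - α / 2)) / 2)
      (le_csSup hbdd (achievable_of_lt h1 (by linarith) (by linarith)))
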